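/- Let J be a finite-dimensional Jordan algebra over a field k of characteristic ≠ 2, let e ∈ J be an idempotent, and let N be a nilpotent ideal of J with N^⟨4⟩ = 0, N = N_0 ⊕ N_{1/2} (where N_i = N ∩ J_i(e)), dim_k N_0 = 1, dim_k N_{1/2} = 2, and dim_k N·N = 2. Then (N_{1/2}·N_0)·N_0 = 0 and (N_0·N_{1/2})·N_{1/2} = 0. -/

import Mathlib

variable {k : Type*} [Field k] {J : Type*} [NonUnitalNonAssocCommRing J]
  [Module k J] [SMulCommClass k J J] [IsScalarTower k J J]

/-- The Peirce component `J_c(e) = {x ∈ J : e·x = c·x}`, a `k`-subspace of `J`. -/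
def peirceComp (e : J) (c : k) : Submodule k J where
  carrier := {x : J | e * x = c • x}
  add_mem' := by
    intro a b ha hb
    simp only [Set.mem_setOf_eq] at *
    rw [mul_add, ha, hb, smul_add]
  zero_mem' := by simp
  smul_mem' := by
    intro r x hx
    simp only [Set.mem_setOf_eq] at *
    rw [mul_smul_comm, hx, smul_comm]

/-- For subspaces `A, B ⊆ J`, `A·B` is the `k`-subspace spanned by all products `a·b`
with `a ∈ A`, `b ∈ B`. -/
def submoduleMul (A B : Submodule k J) : Submodule k J :=
  Submodule.span k {z : J | ∃ a ∈ A, ∃ b ∈ B, z = a * b}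

/-- The descending series of a subspace `N`: `nseries N 0 = N^⟨1⟩ = N` and
`nseries N m = N^⟨m+1⟩ = N^⟨m⟩·N`. -/
def nseries (N : Submodule k J) : ℕ → Submodule k J
  | 0 => N
  | m + 1 => submoduleMul (nseries N m) N

theorem jordan_lin (hchar : (2 : k) ≠ 0)
    (hJordan : ∀ x y : J, ((x * x) * y) * x = (x * x) * (y * x)) (x z y : J) :
    ((x * x) * y) * z + (2:k) • (((x * z) * y) * x)
      = (x * x) * (y * z) + (2:k) • ((x * z) * (y * x)) := by
  have h1 := hJordan (z + x) y
  have h2 := hJordan (z - x) y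
  have h3 := hJordan z y
  have hz : z * x = x * z := mul_comm _ _
  simp only [mul_add, add_mul, mul_sub, sub_mul, hz] at h1 h2
  have e2 : (2:k) • (((x * x) * y) * z + (2:k) • (((x * z) * y) * x)
      - ((x * x) * (y * z) + (2:k) • ((x * z) * (y * x)))) = 0 := by
    rw [← sub_eq_zero] at h1 h2 h3
    have h4 := congrArg₂ (· + ·) h1 h2
    have h5 := congrArg₂ (· - ·) h4 (congrArg₂ (· + ·) h3 h3)
    simp only [add_zero, sub_zero] at h5
    rw [← h5]
    module
  rcases smul_eq_zero.mp e2 with h | h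
  · exact absurd h hchar
  · exact sub_eq_zero.mp h

theorem mul_mem_series (N : Submodule k J) (m : ℕ) {x y : J} (hx : x ∈ nseries N m) (hy : y ∈ N) :
    x * y ∈ nseries N (m+1) :=
  Submodule.subset_span ⟨x, hx, y, hy, rfl⟩

theorem submoduleMul_triple (A B C : Submodule k J)
    (h : ∀ a ∈ A, ∀ b ∈ B, ∀ c ∈ C, (a * b) * c = 0) :
    submoduleMul (submoduleMul A B) C = ⊥ := by
  unfold submoduleMul
  rw [Submodule.span_eq_bot]
  rintro z ⟨p, hp, c, hc, rfl⟩
  induction hp using Submodule.span_induction with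
  | mem x hx => obtain ⟨a, ha, b, hb, rfl⟩ := hx; exact h a ha b hb c hc
  | zero => simp
  | add x y _ _ hx hy => rw [add_mul, hx, hy, add_zero]
  | smul r x _ hx => rw [smul_mul_assoc, hx, smul_zero]

/-- Let `J` be a finite-dimensional Jordan algebra over a field `k` of characteristic ≠ 2,
`e` an idempotent, `N` a nilpotent ideal with `N^⟨4⟩ = 0`, `N = N_0 ⊕ N_{1/2}` (with
`N_i = N ∩ J_i(e)`), `dim N_0 = 1`, `dim N_{1/2} = 2` and `dim N·N = 2`. Then
`(N_{1/2}·N_0)·N_0 = 0` and `(N_0·N_{1/2})·N_{1/2} = 0`. -/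
theorem half_dim_two_products_vanish (hchar : (2 : k) ≠ 0)
    [FiniteDimensional k J]
    (hJordan : ∀ x y : J, ((x * x) * y) * x = (x * x) * (y * x))
    (e : J) (he : e * e = e) (hne : e ≠ 0)
    (N : Submodule k J) (hideal : ∀ x ∈ N, ∀ y : J, x * y ∈ N)
    (hN4 : nseries N 3 = ⊥)
    (hdecomp : (N ⊓ peirceComp e (0 : k)) ⊔ (N ⊓ peirceComp e (2⁻¹ : k)) = N)
    (h0 : Module.finrank k ↥(N ⊓ peirceComp e (0 : k)) = 1)
    (hhalf : Module.finrank k ↥(N ⊓ peirceComp e (2⁻¹ : k)) = 2)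
    (hNN : Module.finrank k ↥(submoduleMul N N) = 2) :
    submoduleMul (submoduleMul (N ⊓ peirceComp e (2⁻¹ : k)) (N ⊓ peirceComp e (0 : k)))
        (N ⊓ peirceComp e (0 : k)) = ⊥ ∧
    submoduleMul (submoduleMul (N ⊓ peirceComp e (0 : k)) (N ⊓ peirceComp e (2⁻¹ : k)))
        (N ⊓ peirceComp e (2⁻¹ : k)) = ⊥ := by
  have memP : ∀ (c : k) (x : J), x ∈ peirceComp e c ↔ e * x = c • x := fun c x => Iff.rfl
  have lin := jordan_lin hchar hJordan
  have prod4 : ∀ x ∈ N, ∀ y ∈ N, ∀ z ∈ N, ∀ w ∈ N, ((x * y) * z) * w = 0 := by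
    intro x hx y hy z hz w hw
    have h : ((x * y) * z) * w ∈ nseries N 3 :=
      mul_mem_series N 2 (mul_mem_series N 1 (mul_mem_series N 0 hx hy) hz) hw
    rw [hN4] at h
    simpa using h
  -- Peirce rules
  have P0h : ∀ a ∈ N ⊓ peirceComp e (0 : k), ∀ u ∈ N ⊓ peirceComp e (2⁻¹ : k),
      a * u ∈ N ⊓ peirceComp e (2⁻¹ : k) := by
    intro a ha u hu
    refine ⟨hideal a ha.1 u, ?_⟩
    have h1 := (memP _ _).1 ha.2
    have h2 := (memP _ _).1 hu.2
    have h3 := lin e a u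
    rw [he, h1, h2] at h3
    simp only [zero_smul, zero_mul, smul_zero, add_zero, smul_mul_assoc] at h3
    show e * (a * u) = (2⁻¹ : k) • (a * u)
    rw [mul_comm a u, ← h3]
  have Psq : ∀ u ∈ N ⊓ peirceComp e (2⁻¹ : k), u * u ∈ N ⊓ peirceComp e (0 : k) := by
    intro u hu
    have huN := hideal u hu.1 u
    have h2 := (memP _ _).1 hu.2
    have h3 := lin u e e
    rw [he, mul_comm u e, h2] at h3
    simp only [smul_mul_assoc, mul_smul_comm, mul_comm u e, h2] at h3
    have h4 : (u * u * e) * e = u * u * e := add_right_cancel h3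
    have h5 := huN
    rw [← hdecomp, Submodule.mem_sup] at h5
    obtain ⟨p, hp, q, hq, hpq⟩ := h5
    have hp' := (memP _ _).1 hp.2
    have hq' := (memP _ _).1 hq.2
    rw [← hpq, mul_comm (p + q) e, mul_add, hp', hq', mul_comm _ e] at h4
    simp only [zero_smul, zero_add, mul_smul_comm, hq', smul_smul] at h4
    have h6 : ((2⁻¹ : k) * 2⁻¹ - 2⁻¹) • q = 0 := by rw [sub_smul, h4, sub_self]
    have h7 : ((2⁻¹ : k) * 2⁻¹ - 2⁻¹) ≠ 0 := by
      intro h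
      have : (2:k) * 2 * ((2⁻¹ : k) * 2⁻¹ - 2⁻¹) = -1 := by field_simp; ring
      rw [h, mul_zero] at this
      exact one_ne_zero (neg_eq_zero.mp this.symm)
    have hq0 := (smul_eq_zero.mp h6).resolve_left h7
    rw [← hpq, hq0, add_zero]
    exact hp
  have Phh : ∀ u ∈ N ⊓ peirceComp e (2⁻¹ : k), ∀ v ∈ N ⊓ peirceComp e (2⁻¹ : k),
      u * v ∈ N ⊓ peirceComp e (0 : k) := by
    intro u hu v hv
    have h := Submodule.smul_mem _ (2⁻¹ : k) (Submodule.sub_mem _ (Submodule.sub_mem _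
      (Psq _ (Submodule.add_mem _ hu hv)) (Psq _ hu)) (Psq _ hv))
    convert h using 1
    rw [eq_inv_smul_iff₀ hchar]
    simp only [mul_add, add_mul, mul_comm v u]
    module
  constructor
  · apply submoduleMul_triple
    intro u hu a ha b hb
    -- b is a multiple of a, or a = 0
    by_cases ha0 : a = 0
    · simp [ha0]
    obtain ⟨c, hc⟩ := (finrank_eq_one_iff_of_nonzero' (⟨a, ha⟩ : ↥(N ⊓ peirceComp e (0 : k)))
      (by simpa [Subtype.ext_iff] using ha0)).1 h0 ⟨b, hb⟩
    have hc' : c • a = b := congrArg Subtype.val hc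
    rw [← hc', mul_smul_comm]
    suffices h : (u * a) * a = 0 by rw [h, smul_zero]
    by_contra hw
    have hua : u * a ∈ N ⊓ peirceComp e (2⁻¹ : k) := by rw [mul_comm]; exact P0h a ha u hu
    have huaa : (u * a) * a ∈ N ⊓ peirceComp e (2⁻¹ : k) := by
      rw [mul_comm]; exact P0h a ha _ hua
    have h3 := prod4 u hu.1 a ha.1 a ha.1 a ha.1
    have li : LinearIndependent k (![⟨u, hu⟩, ⟨u * a, hua⟩, ⟨(u * a) * a, huaa⟩] :
        Fin 3 → ↥(N ⊓ peirceComp e (2⁻¹ : k))) := by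
      rw [Fintype.linearIndependent_iff]
      intro g hg
      have hg0 := congrArg Subtype.val hg
      simp [Fin.sum_univ_three] at hg0
      have hg1 := congrArg (· * a) hg0
      simp only [add_mul, smul_mul_assoc, h3, smul_zero, add_zero, zero_mul] at hg1
      have hg2 := congrArg (· * a) hg1
      simp only [add_mul, smul_mul_assoc, h3, smul_zero, add_zero, zero_mul] at hg2
      have g0 := (smul_eq_zero.mp hg2).resolve_right hw
      rw [g0, zero_smul, zero_add] at hg1
      have g1 := (smul_eq_zero.mp hg1).resolve_right hw
      rw [g0, g1, zero_smul, zero_smul, zero_add, zero_add] at hg0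
      have g2 := (smul_eq_zero.mp hg0).resolve_right hw
      intro i
      fin_cases i <;> assumption
    have := li.fintype_card_le_finrank
    rw [hhalf] at this
    simp at this
  · apply submoduleMul_triple
    intro a ha u hu v hv
    by_contra hb
    have hbm := Phh _ (P0h a ha u hu) v hv
    obtain ⟨c, hc⟩ := (finrank_eq_one_iff_of_nonzero'
      (⟨(a * u) * v, hbm⟩ : ↥(N ⊓ peirceComp e (0 : k)))
      (by simpa [Subtype.ext_iff] using hb)).1 h0 ⟨a, ha⟩
    have hc' : c • ((a * u) * v) = a := congrArg Subtype.val hc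
    apply hb
    have : a * u = 0 := by
      conv_lhs => rw [← hc']
      rw [smul_mul_assoc, prod4 a ha.1 u hu.1 v hv.1 u hu.1, smul_zero]
    rw [this, zero_mul]
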